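/- There exist universal constants c > 0 and C > 0 such that for every nonempty finite set X, all distributions p, q on X with d_TV(p,q) > 0, every ε with 0 ≤ ε ≤ d_TV(p,q)/4, and every model A ∈ {Hub, TV, Sub}: c/d_TV(p,q) ≤ n*_A(p,q,ε) ≤ C/d_TV(p,q)²; in particular n*_A(p,q,ε) is finite. -/

import Mathlib

open scoped Classical ENNReal
open Finset

noncomputable section

/-- A probability distribution on a finite set. -/
def IsDist {X : Type*} [Fintype X] (p : X → ℝ) : Prop :=
  (∀ x, 0 ≤ p x) ∧ ∑ x, p x = 1

/-- Total variation distance. -/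
def dTV {X : Type*} [Fintype X] (p q : X → ℝ) : ℝ :=
  (1 / 2) * ∑ x, |p x - q x|

/-- Squared Hellinger divergence (also for unnormalized nonnegative vectors). -/
def hellSq {X : Type*} [Fintype X] (p q : X → ℝ) : ℝ :=
  ∑ x, (Real.sqrt (p x) - Real.sqrt (q x)) ^ 2

/-- ε-Huber uncertainty set. -/
def PHub {X : Type*} [Fintype X] (p : X → ℝ) (ε : ℝ) : Set (X → ℝ) :=
  {p' | IsDist p' ∧ ∀ x, (1 - ε) * p x ≤ p' x}

/-- ε-TV uncertainty set. -/
def PTV {X : Type*} [Fintype X] (p : X → ℝ) (ε : ℝ) : Set (X → ℝ) :=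
  {p' | IsDist p' ∧ dTV p' p ≤ ε}

/-- ε-subtractive uncertainty set. -/
def PSub {X : Type*} [Fintype X] (p : X → ℝ) (ε : ℝ) : Set (X → ℝ) :=
  {p' | IsDist p' ∧ ∀ x, p' x ≤ (1 + ε) * p x}

/-- Sum of worst-case type-I and type-II errors of a randomized test `φ` on `n`
i.i.d. samples, for composite hypotheses `Pcal` vs `Qcal`. -/
def errSum {X : Type*} [Fintype X] (Pcal Qcal : Set (X → ℝ)) (n : ℕ)
    (φ : (Fin n → X) → ℝ) : ℝ :=
  (⨆ P : Pcal, ∑ x : Fin n → X, (∏ i, (P : X → ℝ) (x i)) * φ x) +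
  (⨆ Q : Qcal, ∑ x : Fin n → X, (∏ i, (Q : X → ℝ) (x i)) * (1 - φ x))

/-- Minimax `n`-sample error for testing `Pcal` against `Qcal`. -/
def eStar {X : Type*} [Fintype X] (Pcal Qcal : Set (X → ℝ)) (n : ℕ) : ℝ :=
  ⨅ φ : {φ : (Fin n → X) → ℝ // ∀ x, 0 ≤ φ x ∧ φ x ≤ 1}, errSum Pcal Qcal n φ.1

/-- Sample complexity: the least `n` with minimax error at most `1/10` (`⊤` if none). -/
def nStar {X : Type*} [Fintype X] (Pcal Qcal : Set (X → ℝ)) : ℝ≥0∞ :=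
  sInf {N : ℝ≥0∞ | ∃ n : ℕ, N = (n : ℝ≥0∞) ∧ eStar Pcal Qcal n ≤ 1 / 10}

section IidTesting

variable {X : Type*} [Fintype X]

/-- Expectation of `g` under `n` i.i.d. samples from `P`. -/
def iidMean (P : X → ℝ) (n : ℕ) (g : (Fin n → X) → ℝ) : ℝ :=
  ∑ x : Fin n → X, (∏ i, P (x i)) * g x

lemma iidMean_succ (P : X → ℝ) (n : ℕ) (g : (Fin (n + 1) → X) → ℝ) :
    iidMean P (n + 1) g = ∑ a, P a * iidMean P n (fun x => g (Fin.cons a x)) := by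
  unfold iidMean
  rw [← (Fin.consEquiv (fun _ : Fin (n + 1) => X)).sum_comp, Fintype.sum_prod_type]
  simp [Fin.consEquiv, Fin.prod_univ_succ, Finset.mul_sum, mul_assoc]

lemma iidMean_add (P : X → ℝ) (n : ℕ) (g h : (Fin n → X) → ℝ) :
    iidMean P n (fun x => g x + h x) = iidMean P n g + iidMean P n h := by
  simp [iidMean, mul_add, Finset.sum_add_distrib]

lemma iidMean_sub (P : X → ℝ) (n : ℕ) (g h : (Fin n → X) → ℝ) :
    iidMean P n (fun x => g x - h x) = iidMean P n g - iidMean P n h := by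
  simp [iidMean, mul_sub, Finset.sum_sub_distrib]

lemma iidMean_const_mul (P : X → ℝ) (n : ℕ) (c : ℝ) (g : (Fin n → X) → ℝ) :
    iidMean P n (fun x => c * g x) = c * iidMean P n g := by
  simp only [iidMean, Finset.mul_sum]
  exact Finset.sum_congr rfl fun _ _ => by ring

lemma iidMean_const {P : X → ℝ} (hP : IsDist P) (n : ℕ) (c : ℝ) :
    iidMean P n (fun _ => c) = c := by
  induction n with
  | zero => simp [iidMean]
  | succ n ih => simp [iidMean_succ, ih, ← Finset.sum_mul, hP.2]

lemma iidMean_mono {P : X → ℝ} (hP : IsDist P) {n : ℕ} {g h : (Fin n → X) → ℝ}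
    (hgh : ∀ x, g x ≤ h x) : iidMean P n g ≤ iidMean P n h :=
  Finset.sum_le_sum fun x _ =>
    mul_le_mul_of_nonneg_left (hgh x) (Finset.prod_nonneg fun i _ => hP.1 (x i))

lemma iidMean_nonneg {P : X → ℝ} (hP : IsDist P) {n : ℕ} {g : (Fin n → X) → ℝ}
    (hg : ∀ x, 0 ≤ g x) : 0 ≤ iidMean P n g :=
  (iidMean_const hP n 0).symm.le.trans (iidMean_mono hP hg)

lemma iidMean_le_one {P : X → ℝ} (hP : IsDist P) {n : ℕ} {g : (Fin n → X) → ℝ}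
    (hg : ∀ x, g x ≤ 1) : iidMean P n g ≤ 1 :=
  (iidMean_mono hP hg).trans (iidMean_const hP n 1).le

lemma iidMean_sum_eq_zero {P : X → ℝ} (hP : IsDist P) {h : X → ℝ} (hh : ∑ a, P a * h a = 0)
    (n : ℕ) : iidMean P n (fun x => ∑ i, h (x i)) = 0 := by
  induction n with
  | zero => simp [iidMean]
  | succ n ih =>
    simp only [iidMean_succ, Fin.sum_univ_succ, Fin.cons_zero, Fin.cons_succ, iidMean_add,
      iidMean_const hP, ih, add_zero, hh]

lemma iidMean_sum_sq {P : X → ℝ} (hP : IsDist P) {h : X → ℝ} (hh : ∑ a, P a * h a = 0)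
    (n : ℕ) : iidMean P n (fun x => (∑ i, h (x i)) ^ 2) = n * ∑ a, P a * h a ^ 2 := by
  induction n with
  | zero => simp [iidMean]
  | succ n ih =>
    have key : ∀ a, iidMean P n (fun x => (h a + ∑ i, h (x i)) ^ 2)
        = h a ^ 2 + n * ∑ a, P a * h a ^ 2 := by
      intro a
      have hexp : (fun x : Fin n → X => (h a + ∑ i, h (x i)) ^ 2) =
          fun x => (h a ^ 2 + 2 * h a * ∑ i, h (x i)) + (∑ i, h (x i)) ^ 2 := by
        funext x; ring
      rw [hexp, iidMean_add, iidMean_add, iidMean_const hP, iidMean_const_mul,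
        iidMean_sum_eq_zero hP hh, ih]
      ring
    simp only [iidMean_succ, Fin.sum_univ_succ, Fin.cons_zero, Fin.cons_succ, key, mul_add,
      Finset.sum_add_distrib, ← Finset.sum_mul, hP.2]
    push_cast
    ring

/-- Chebyshev's inequality for the sum of a `[0,1]`-valued statistic. -/
lemma iidMean_chebyshev {P : X → ℝ} (hP : IsDist P) {f : X → ℝ} (hf : ∀ a, 0 ≤ f a ∧ f a ≤ 1)
    {n : ℕ} {r : ℝ} {ψ : (Fin n → X) → ℝ}
    (hψ : ∀ x, ψ x * r ^ 2 ≤ (∑ i, f (x i) - n * ∑ a, P a * f a) ^ 2) :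
    iidMean P n ψ * r ^ 2 ≤ n := by
  set m := ∑ a, P a * f a with hm
  have hm0 : 0 ≤ m := Finset.sum_nonneg fun a _ => mul_nonneg (hP.1 a) (hf a).1
  have hm1 : m ≤ 1 := by
    rw [← hP.2]
    exact Finset.sum_le_sum fun a _ => mul_le_of_le_one_right (hP.1 a) (hf a).2
  have hcent : ∑ a, P a * (f a - m) = 0 := by
    simp [mul_sub, Finset.sum_sub_distrib, ← Finset.sum_mul, hP.2, ← hm]
  have hvar : ∑ a, P a * (f a - m) ^ 2 ≤ 1 := by
    rw [← hP.2]
    refine Finset.sum_le_sum fun a _ => mul_le_of_le_one_right (hP.1 a) ?_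
    nlinarith [(hf a).1, (hf a).2]
  calc iidMean P n ψ * r ^ 2 = iidMean P n (fun x => r ^ 2 * ψ x) := by
        rw [iidMean_const_mul, mul_comm]
    _ ≤ iidMean P n (fun x => (∑ i, (f (x i) - m)) ^ 2) := by
        refine iidMean_mono hP fun x => ?_
        rw [mul_comm]
        simpa [Finset.sum_sub_distrib] using hψ x
    _ = n * ∑ a, P a * (f a - m) ^ 2 := iidMean_sum_sq hP hcent n
    _ ≤ n := mul_le_of_le_one_right (Nat.cast_nonneg n) hvar

lemma dTV_comm (p q : X → ℝ) : dTV p q = dTV q p := by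
  simp only [dTV, abs_sub_comm]

lemma dTV_self (p : X → ℝ) : dTV p p = 0 := by
  simp [dTV]

lemma dTV_le_one {p q : X → ℝ} (hp : IsDist p) (hq : IsDist q) : dTV p q ≤ 1 := by
  have h : ∑ x, |p x - q x| ≤ ∑ x, (p x + q x) :=
    Finset.sum_le_sum fun x _ => abs_le.2 ⟨by linarith [hp.1 x], by linarith [hq.1 x]⟩
  rw [Finset.sum_add_distrib, hp.2, hq.2] at h
  unfold dTV
  linarith

lemma sum_sub_mul_eq {p q : X → ℝ} (hp : IsDist p) (hq : IsDist q) (g : X → ℝ) :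
    ∑ a, p a * g a - ∑ a, q a * g a = ∑ a, (p a - q a) * (g a - 1 / 2) := by
  have h : ∑ a, (p a - q a) * (1 / 2 : ℝ) = 0 := by
    rw [← Finset.sum_mul, Finset.sum_sub_distrib, hp.2, hq.2]; ring
  simp only [mul_sub, Finset.sum_sub_distrib, sub_mul]
  simp only [sub_mul, Finset.sum_sub_distrib] at h
  linarith

lemma sum_mul_sub_le_dTV {p q : X → ℝ} (hp : IsDist p) (hq : IsDist q) {g : X → ℝ}
    (hg : ∀ a, 0 ≤ g a ∧ g a ≤ 1) : ∑ a, p a * g a - ∑ a, q a * g a ≤ dTV p q := by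
  rw [sum_sub_mul_eq hp hq, dTV, Finset.mul_sum]
  refine Finset.sum_le_sum fun a _ => (le_abs_self _).trans ?_
  rw [abs_mul, mul_comm]
  refine mul_le_mul_of_nonneg_right (abs_le.2 ⟨?_, ?_⟩) (abs_nonneg _)
  · linarith [(hg a).1]
  · linarith [(hg a).2]

lemma sum_mul_sub_scheffe {p q : X → ℝ} (hp : IsDist p) (hq : IsDist q) :
    ∑ a, p a * (if q a ≤ p a then 1 else 0) - ∑ a, q a * (if q a ≤ p a then 1 else 0)
      = dTV p q := by
  rw [sum_sub_mul_eq hp hq (fun a => if q a ≤ p a then 1 else 0), dTV, Finset.mul_sum]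
  refine Finset.sum_congr rfl fun a _ => ?_
  split_ifs with h
  · rw [abs_of_nonneg (by linarith)]; ring
  · rw [abs_of_neg (by linarith)]; ring

/-- Subadditivity of total variation over product distributions. -/
lemma iidMean_sub_le {p q : X → ℝ} (hp : IsDist p) (hq : IsDist q) (n : ℕ) :
    ∀ φ : (Fin n → X) → ℝ, (∀ x, 0 ≤ φ x ∧ φ x ≤ 1) →
      iidMean p n φ - iidMean q n φ ≤ n * dTV p q := by
  induction n with
  | zero => intro φ _; simp [iidMean]
  | succ n ih =>
    intro φ hφ
    rw [iidMean_succ, iidMean_succ]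
    have h₁ : ∑ a, p a * iidMean p n (fun x => φ (Fin.cons a x))
        ≤ ∑ a, p a * (iidMean q n (fun x => φ (Fin.cons a x)) + n * dTV p q) :=
      Finset.sum_le_sum fun a _ => mul_le_mul_of_nonneg_left
        (by linarith [ih (fun x => φ (Fin.cons a x)) fun x => hφ _]) (hp.1 a)
    have h₂ := sum_mul_sub_le_dTV hp hq (g := fun a => iidMean q n (fun x => φ (Fin.cons a x)))
      fun a => ⟨iidMean_nonneg hq fun x => (hφ _).1, iidMean_le_one hq fun x => (hφ _).2⟩
    simp only [mul_add, Finset.sum_add_distrib, ← Finset.sum_mul, hp.2] at h₁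
    push_cast
    linarith

lemma errSum_eq (Pcal Qcal : Set (X → ℝ)) (n : ℕ) (φ : (Fin n → X) → ℝ) :
    errSum Pcal Qcal n φ =
      (⨆ P : Pcal, iidMean P n φ) + ⨆ Q : Qcal, iidMean Q n (fun x => 1 - φ x) := rfl

lemma le_iSup_iidMean {Pcal : Set (X → ℝ)} (hPcal : ∀ P ∈ Pcal, IsDist P) {p : X → ℝ}
    (hp : p ∈ Pcal) {n : ℕ} {φ : (Fin n → X) → ℝ} (hφ : ∀ x, φ x ≤ 1) :
    iidMean p n φ ≤ ⨆ P : Pcal, iidMean P n φ := by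
  refine le_ciSup (f := fun P : Pcal => iidMean (P : X → ℝ) n φ) ⟨1, ?_⟩ ⟨p, hp⟩
  rintro _ ⟨P, rfl⟩
  exact iidMean_le_one (hPcal P P.2) hφ

lemma one_sub_le_eStar {Pcal Qcal : Set (X → ℝ)} (hPcal : ∀ P ∈ Pcal, IsDist P)
    (hQcal : ∀ Q ∈ Qcal, IsDist Q) {p q : X → ℝ} (hp : p ∈ Pcal) (hq : q ∈ Qcal) (n : ℕ) :
    1 - n * dTV p q ≤ eStar Pcal Qcal n := by
  have : Nonempty {φ : (Fin n → X) → ℝ // ∀ x, 0 ≤ φ x ∧ φ x ≤ 1} :=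
    ⟨⟨fun _ => 0, fun _ => ⟨le_rfl, zero_le_one⟩⟩⟩
  refine le_ciInf fun φ => ?_
  rw [errSum_eq]
  have h₁ := le_iSup_iidMean hPcal hp fun x => (φ.2 x).2
  have h₂ := le_iSup_iidMean hQcal hq (φ := fun x => 1 - φ.1 x)
    fun x => by linarith [(φ.2 x).1]
  rw [iidMean_sub, iidMean_const (hQcal q hq)] at h₂
  have h₃ := iidMean_sub_le (hQcal q hq) (hPcal p hp) n φ.1 φ.2
  rw [dTV_comm] at h₃
  linarith

lemma eStar_le_errSum {Pcal Qcal : Set (X → ℝ)} (hPcal : ∀ P ∈ Pcal, IsDist P)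
    (hQcal : ∀ Q ∈ Qcal, IsDist Q) {n : ℕ} {φ : (Fin n → X) → ℝ}
    (hφ : ∀ x, 0 ≤ φ x ∧ φ x ≤ 1) : eStar Pcal Qcal n ≤ errSum Pcal Qcal n φ := by
  refine ciInf_le (f := fun φ : {φ : (Fin n → X) → ℝ // ∀ x, 0 ≤ φ x ∧ φ x ≤ 1} =>
    errSum Pcal Qcal n φ.1) ⟨0, ?_⟩ ⟨φ, hφ⟩
  rintro _ ⟨ψ, rfl⟩
  simp only [errSum_eq]
  exact add_nonneg
    (Real.iSup_nonneg fun P => iidMean_nonneg (hPcal P P.2) fun x => (ψ.2 x).1)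
    (Real.iSup_nonneg fun Q => iidMean_nonneg (hQcal Q Q.2) fun x => by linarith [(ψ.2 x).2])

lemma eStar_le_of_sample_size {Pcal Qcal : Set (X → ℝ)} {p q : X → ℝ} {ε : ℝ}
    (hP : IsDist p) (hQ : IsDist q) (hp : p ∈ Pcal) (hq : q ∈ Qcal)
    (hPcal : Pcal ⊆ PTV p ε) (hQcal : Qcal ⊆ PTV q ε) (hd : 0 < dTV p q)
    (hε : ε ≤ dTV p q / 4) {n : ℕ} (hn : 320 ≤ n * dTV p q ^ 2) :
    eStar Pcal Qcal n ≤ 1 / 10 := by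
  set d := dTV p q with hd_def
  set f : X → ℝ := fun a => if q a ≤ p a then 1 else 0 with hf_def
  have hf : ∀ a, 0 ≤ f a ∧ f a ≤ 1 := fun a => by
    simp only [hf_def]; split_ifs <;> norm_num
  have hgap : ∑ a, p a * f a - ∑ a, q a * f a = d := sum_mul_sub_scheffe hP hQ
  set t := (∑ a, p a * f a + ∑ a, q a * f a) / 2 with ht
  have hn0 : (0 : ℝ) ≤ n := Nat.cast_nonneg n
  have hnd : 0 ≤ n * (d / 4) := by positivity
  have tail : ∀ m : ℝ, m * (n * (d / 4)) ^ 2 ≤ n → m ≤ 1 / 20 := by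
    intro m hm
    by_contra! h
    have hpos : (0 : ℝ) < n := by
      rcases hn0.eq_or_lt with h0 | h0
      · rw [← h0] at hn; norm_num at hn
      · exact h0
    have : n * (m * (n * d ^ 2)) ≤ n * 16 := by linarith
    have := le_of_mul_le_mul_left this hpos
    nlinarith
  set φ : (Fin n → X) → ℝ := fun x => if ∑ i, f (x i) ≤ n * t then 1 else 0 with hφ_def
  have hφ : ∀ x, 0 ≤ φ x ∧ φ x ≤ 1 := fun x => by
    simp only [hφ_def]; split_ifs <;> norm_num
  refine (eStar_le_errSum (fun P h => (hPcal h).1) (fun Q h => (hQcal h).1) hφ).trans ?_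
  have : Nonempty Pcal := ⟨⟨p, hp⟩⟩
  have : Nonempty Qcal := ⟨⟨q, hq⟩⟩
  have h₁ : (⨆ P : Pcal, iidMean (P : X → ℝ) n φ) ≤ 1 / 20 := by
    refine ciSup_le fun ⟨P, hPm⟩ => tail _ (iidMean_chebyshev (hPcal hPm).1 hf fun x => ?_)
    have hmean : t + d / 4 ≤ ∑ a, P a * f a := by
      have h := sum_mul_sub_le_dTV hP (hPcal hPm).1 hf
      rw [dTV_comm] at h
      linarith [(hPcal hPm).2]
    have := mul_le_mul_of_nonneg_left hmean hn0
    simp only [hφ_def]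
    split_ifs with hx
    · nlinarith
    · nlinarith [sq_nonneg (∑ i, f (x i) - n * ∑ a, P a * f a)]
  have h₂ : (⨆ Q : Qcal, iidMean (Q : X → ℝ) n (fun x => 1 - φ x)) ≤ 1 / 20 := by
    refine ciSup_le fun ⟨Q, hQm⟩ => tail _ (iidMean_chebyshev (hQcal hQm).1 hf fun x => ?_)
    have hmean : ∑ a, Q a * f a ≤ t - d / 4 := by
      have h := sum_mul_sub_le_dTV (hQcal hQm).1 hQ hf
      linarith [(hQcal hQm).2]
    have := mul_le_mul_of_nonneg_left hmean hn0
    simp only [hφ_def]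
    split_ifs with hx
    · nlinarith [sq_nonneg (∑ i, f (x i) - n * ∑ a, Q a * f a)]
    · push Not at hx
      nlinarith
  rw [errSum_eq]
  linarith

/-- Two-sided bound for any uncertainty sets contained in the total variation balls. -/
lemma nStar_bounds_of_subset_PTV {Pcal Qcal : Set (X → ℝ)} {p q : X → ℝ} {ε : ℝ}
    (hP : IsDist p) (hQ : IsDist q) (hp : p ∈ Pcal) (hq : q ∈ Qcal)
    (hPcal : Pcal ⊆ PTV p ε) (hQcal : Qcal ⊆ PTV q ε) (hd : 0 < dTV p q)
    (hε : ε ≤ dTV p q / 4) :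
    ENNReal.ofReal (9 / 10 / dTV p q) ≤ nStar Pcal Qcal ∧
      nStar Pcal Qcal ≤ ENNReal.ofReal (321 / dTV p q ^ 2) ∧ nStar Pcal Qcal ≠ ⊤ := by
  have hupper : nStar Pcal Qcal ≤ ENNReal.ofReal (321 / dTV p q ^ 2) := by
    have hd2 : 0 < dTV p q ^ 2 := by positivity
    have hceil : 320 ≤ (⌈320 / dTV p q ^ 2⌉₊ : ℝ) * dTV p q ^ 2 :=
      (div_le_iff₀ hd2).1 (Nat.le_ceil _)
    have hmem := eStar_le_of_sample_size hP hQ hp hq hPcal hQcal hd hε hceil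
    have hle : nStar Pcal Qcal ≤ (⌈320 / dTV p q ^ 2⌉₊ : ℝ≥0∞) := sInf_le ⟨_, rfl, hmem⟩
    refine hle.trans ?_
    rw [← ENNReal.ofReal_natCast]
    refine ENNReal.ofReal_le_ofReal ((Nat.ceil_lt_add_one (by positivity)).le.trans ?_)
    rw [le_div_iff₀ hd2, add_mul, div_mul_cancel₀ _ hd2.ne']
    nlinarith [dTV_le_one hP hQ]
  refine ⟨le_sInf ?_, hupper, ne_top_of_le_ne_top ENNReal.ofReal_ne_top hupper⟩
  rintro _ ⟨n, rfl, hn⟩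
  rw [← ENNReal.ofReal_natCast]
  refine ENNReal.ofReal_le_ofReal ((div_le_iff₀ hd).2 ?_)
  linarith [one_sub_le_eStar (fun P h => (hPcal h).1) (fun Q h => (hQcal h).1) hp hq n]

lemma mem_PHub_self {p : X → ℝ} (hp : IsDist p) {ε : ℝ} (hε : 0 ≤ ε) : p ∈ PHub p ε :=
  ⟨hp, fun x => by nlinarith [hp.1 x]⟩

lemma mem_PTV_self {p : X → ℝ} (hp : IsDist p) {ε : ℝ} (hε : 0 ≤ ε) : p ∈ PTV p ε :=
  ⟨hp, (dTV_self p).trans_le hε⟩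

lemma mem_PSub_self {p : X → ℝ} (hp : IsDist p) {ε : ℝ} (hε : 0 ≤ ε) : p ∈ PSub p ε :=
  ⟨hp, fun x => by nlinarith [hp.1 x]⟩

lemma dTV_le_of_sub_le {r s p : X → ℝ} (hr : IsDist r) (hs : IsDist s) (hp : IsDist p) {ε : ℝ}
    (hε : 0 ≤ ε) (h : ∀ x, r x - s x ≤ ε * p x) : dTV r s ≤ ε := by
  rw [← sum_mul_sub_scheffe hr hs, ← Finset.sum_sub_distrib]
  calc _ ≤ ∑ a, ε * p a := Finset.sum_le_sum fun a _ => by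
        split_ifs
        · linarith [h a]
        · linarith [mul_nonneg hε (hp.1 a)]
    _ = ε := by rw [← Finset.mul_sum, hp.2, mul_one]

lemma PHub_subset_PTV {p : X → ℝ} (hp : IsDist p) {ε : ℝ} (hε : 0 ≤ ε) :
    PHub p ε ⊆ PTV p ε := fun p' h =>
  ⟨h.1, (dTV_comm p' p).trans_le
    (dTV_le_of_sub_le hp h.1 hp hε fun x => by linarith [h.2 x])⟩

lemma PSub_subset_PTV {p : X → ℝ} (hp : IsDist p) {ε : ℝ} (hε : 0 ≤ ε) :
    PSub p ε ⊆ PTV p ε := fun _ h =>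
  ⟨h.1, dTV_le_of_sub_le h.1 hp hp hε fun x => by linarith [h.2 x]⟩

end IidTesting

/-- Baseline bounds: for contamination level at most a quarter of the TV distance, the robust
sample complexity in each of the Huber, TV and subtractive models is between
`c/d_TV(p,q)` and `C/d_TV(p,q)^2`; in particular it is finite. -/
theorem baseline_sample_complexity_bounds :
    ∃ c C : ℝ, 0 < c ∧ 0 < C ∧
      ∀ (X : Type) [Fintype X] [Nonempty X] (p q : X → ℝ),
        IsDist p → IsDist q → 0 < dTV p q →
        ∀ ε : ℝ, 0 ≤ ε → ε ≤ dTV p q / 4 →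
          (ENNReal.ofReal (c / dTV p q) ≤ nStar (PHub p ε) (PHub q ε) ∧
            nStar (PHub p ε) (PHub q ε) ≤ ENNReal.ofReal (C / (dTV p q) ^ 2) ∧
            nStar (PHub p ε) (PHub q ε) ≠ ⊤) ∧
          (ENNReal.ofReal (c / dTV p q) ≤ nStar (PTV p ε) (PTV q ε) ∧
            nStar (PTV p ε) (PTV q ε) ≤ ENNReal.ofReal (C / (dTV p q) ^ 2) ∧
            nStar (PTV p ε) (PTV q ε) ≠ ⊤) ∧
          (ENNReal.ofReal (c / dTV p q) ≤ nStar (PSub p ε) (PSub q ε) ∧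
            nStar (PSub p ε) (PSub q ε) ≤ ENNReal.ofReal (C / (dTV p q) ^ 2) ∧
            nStar (PSub p ε) (PSub q ε) ≠ ⊤) := by
  refine ⟨9 / 10, 321, by norm_num, by norm_num, ?_⟩
  intro X _ _ p q hp hq hd ε hε₀ hε
  exact ⟨
    nStar_bounds_of_subset_PTV hp hq (mem_PHub_self hp hε₀) (mem_PHub_self hq hε₀)
      (PHub_subset_PTV hp hε₀) (PHub_subset_PTV hq hε₀) hd hε,
    nStar_bounds_of_subset_PTV hp hq (mem_PTV_self hp hε₀) (mem_PTV_self hq hε₀)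
      subset_rfl subset_rfl hd hε,
    nStar_bounds_of_subset_PTV hp hq (mem_PSub_self hp hε₀) (mem_PSub_self hq hε₀)
      (PSub_subset_PTV hp hε₀) (PSub_subset_PTV hq hε₀) hd hε⟩

end
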